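/- arXiv:1809.00134 — 2 statements merged into one kernel-verified Lean document; each statement's English description precedes it below -/
import Mathlib

section
/- Let L be one of DL-Lite_R or ALCHI, and let 𝒬 be a canonical class of UCQs (a class closed under replacing a concept or role atom in a query with an atom of the same kind). Then for every OMQC Q = (T, Σ_A, Σ_C, q) with T an L TBox, Σ_C ⊆ Σ_A, and q ∈ 𝒬, there exist an L TBox T' and a query q' ∈ 𝒬 such that the OMQC Q' = (T', Σ_A, Σ_A, q') is equivalent to Q, i.e., for all Σ_A-ABoxes A and all tuples a⃗ from Ind(A): A ⊨ Q(a⃗) iff A ⊨ Q'(a⃗). -/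
namespace DL

/-- Roles: role names or inverse roles.  Role names are natural numbers. -/
inductive Role : Type
  | nm (r : ℕ) : Role
  | inv (r : ℕ) : Role
  deriving DecidableEq

/-- The inverse of a role. -/
def Role.flip : Role → Role
  | .nm r => .inv r
  | .inv r => .nm r

/-- The role name occurring in a role. -/
def Role.name : Role → ℕ
  | .nm r => r
  | .inv r => r

/-- Interpretations.  Concept names, role names, and individual names are natural
numbers.  The standard name assumption is modelled by a partial, injective
interpretation `ind` of individual names: `ind a = some d` means that the individual
name `a` belongs to the domain and is (identified with) the element `d`. -/
structure Interp : Type 1 where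
  Dom : Type
  dne : Nonempty Dom
  ind : ℕ → Option Dom
  ind_inj : ∀ a b d, ind a = some d → ind b = some d → a = b
  cInt : ℕ → Set Dom
  rInt : ℕ → Set (Dom × Dom)

/-- Extension of a (possibly inverse) role. -/
def Interp.rI (I : Interp) : Role → Set (I.Dom × I.Dom)
  | .nm r => I.rInt r
  | .inv r => {p | (p.2, p.1) ∈ I.rInt r}

/-- ABoxes: sets of concept assertions `(A, a)` and role assertions `(r, a, b)`. -/
structure ABox : Type where
  ca : Set (ℕ × ℕ)
  ra : Set (ℕ × ℕ × ℕ)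

/-- The individual names occurring in an ABox. -/
def ABox.ind (A : ABox) : Set ℕ :=
  {a | (∃ p ∈ A.ca, p.2 = a) ∨ (∃ t ∈ A.ra, t.2.1 = a ∨ t.2.2 = a)}

/-- The ABox is finite. -/
def ABox.Fin (A : ABox) : Prop := A.ca.Finite ∧ A.ra.Finite

/-- The ABox only uses concept names from `Sc` and role names from `Sr`
(i.e. it is a `S`-ABox for the signature `S = Sc ∪ Sr`). -/
def ABox.usesOnly (A : ABox) (Sc Sr : Set ℕ) : Prop :=
  (∀ p ∈ A.ca, p.1 ∈ Sc) ∧ (∀ t ∈ A.ra, t.1 ∈ Sr)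

/-- `I` is a model of the ABox `A` (under the standard name assumption). -/
def Interp.modelA (I : Interp) (A : ABox) : Prop :=
  (∀ p ∈ A.ca, ∃ d, I.ind p.2 = some d ∧ d ∈ I.cInt p.1) ∧
  (∀ t ∈ A.ra, ∃ d e, I.ind t.2.1 = some d ∧ I.ind t.2.2 = some e ∧ (d, e) ∈ I.rInt t.1)

/-- `I` respects the closed predicates `Sc` (concept names) and `Sr` (role names)
with respect to the ABox `A`: the extension of each closed predicate is exactly
what is asserted in `A`. -/
def Interp.respects (I : Interp) (A : ABox) (Sc Sr : Set ℕ) : Prop :=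
  (∀ B ∈ Sc, ∀ d, d ∈ I.cInt B ↔ ∃ a, I.ind a = some d ∧ (B, a) ∈ A.ca) ∧
  (∀ r ∈ Sr, ∀ d e, (d, e) ∈ I.rInt r ↔ ∃ a b, I.ind a = some d ∧ I.ind b = some e ∧ (r, a, b) ∈ A.ra)

/-- First-order queries built from concept atoms, role atoms and equality using
negation, conjunction, disjunction and existential quantification.
Variables are natural numbers. -/
inductive FO : Type
  | eq (x y : ℕ)
  | capp (B x : ℕ)
  | rapp (r x y : ℕ)
  | neg (φ : FO)
  | conj (φ ψ : FO)
  | disj (φ ψ : FO)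
  | ex (x : ℕ) (φ : FO)

/-- Standard first-order evaluation of a query in an interpretation under an
assignment. -/
def Interp.evalFO (I : Interp) : (ℕ → I.Dom) → FO → Prop
  | v, .eq x y => v x = v y
  | v, .capp B x => v x ∈ I.cInt B
  | v, .rapp r x y => (v x, v y) ∈ I.rInt r
  | v, .neg φ => ¬ I.evalFO v φ
  | v, .conj φ ψ => I.evalFO v φ ∧ I.evalFO v ψ
  | v, .disj φ ψ => I.evalFO v φ ∨ I.evalFO v ψ
  | v, .ex x φ => ∃ d : I.Dom, I.evalFO (Function.update v x d) φ

/-- Free variables of a first-order query. -/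
def FO.free : FO → Set ℕ
  | .eq x y => {x, y}
  | .capp _ x => {x}
  | .rapp _ x y => {x, y}
  | .neg φ => φ.free
  | .conj φ ψ => φ.free ∪ ψ.free
  | .disj φ ψ => φ.free ∪ ψ.free
  | .ex x φ => φ.free \ {x}

/-- Conjunctions of concept and role atoms. -/
inductive IsConjAtoms : FO → Prop
  | capp (B x : ℕ) : IsConjAtoms (.capp B x)
  | rapp (r x y : ℕ) : IsConjAtoms (.rapp r x y)
  | conj {φ ψ : FO} : IsConjAtoms φ → IsConjAtoms ψ → IsConjAtoms (.conj φ ψ)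

/-- Conjunctive queries: existentially quantified conjunctions of atoms. -/
inductive IsCQ : FO → Prop
  | base {φ : FO} : IsConjAtoms φ → IsCQ φ
  | ex {φ : FO} (x : ℕ) : IsCQ φ → IsCQ (.ex x φ)

/-- Unions of conjunctive queries: disjunctions of CQs. -/
inductive IsUCQ : FO → Prop
  | base {φ : FO} : IsCQ φ → IsUCQ φ
  | disj {φ ψ : FO} : IsUCQ φ → IsUCQ ψ → IsUCQ (.disj φ ψ)

/-- `v` maps the answer variables `xs` to (the domain elements named by) the
individual names `as`. -/
def matches' (I : Interp) (xs as : List ℕ) (v : ℕ → I.Dom) : Prop :=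
  ∀ p ∈ List.zip xs as, I.ind p.2 = some (v p.1)

/-- `I ⊨ q(as)`, where `xs` is the list of answer variables of `q`. -/
def Interp.sat (I : Interp) (q : FO) (xs as : List ℕ) : Prop :=
  ∃ v : ℕ → I.Dom, matches' I xs as v ∧ I.evalFO v q

/-- Certain answers of the ontology-mediated query with closed predicates
`(T, Σ_C, q)` where the models of the TBox `T` are given by the predicate `mod`:
`as` is a certain answer to `q` (with answer variables `xs`) over `A` iff every
model of the TBox and `A` that respects the closed predicates satisfies `q(as)`. -/
def certAns (mod : Interp → Prop) (Sc Sr : Set ℕ) (A : ABox) (q : FO) (xs as : List ℕ) : Prop :=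
  ∀ I : Interp, mod I → I.modelA A → I.respects A Sc Sr → I.sat q xs as

/-- `A` is consistent w.r.t. the TBox (given by `mod`) and the closed predicates. -/
def consistentW (mod : Interp → Prop) (Sc Sr : Set ℕ) (A : ABox) : Prop :=
  ∃ I : Interp, mod I ∧ I.modelA A ∧ I.respects A Sc Sr

/-- ALCI concepts. -/
inductive ALCI : Type
  | atom (B : ℕ)
  | top
  | neg (C : ALCI)
  | conj (C D : ALCI)
  | ex (ρ : Role) (C : ALCI)
  deriving DecidableEq

/-- Semantics of ALCI concepts. -/
def Interp.semA (I : Interp) : ALCI → Set I.Dom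
  | .atom B => I.cInt B
  | .top => Set.univ
  | .neg C => (I.semA C)ᶜ
  | .conj C D => I.semA C ∩ I.semA D
  | .ex ρ C => {d | ∃ e, (d, e) ∈ I.rI ρ ∧ e ∈ I.semA C}

/-- ALCHI TBox axioms: concept inclusions between ALCI concepts and role
inclusions between roles. -/
inductive ALCHIAx : Type
  | ci (C D : ALCI)
  | ri (ρ σ : Role)

/-- An ALCHI TBox is a finite list of axioms. -/
abbrev ALCHITBox := List ALCHIAx

/-- `I` is a model of the ALCHI TBox `T`. -/
def Interp.modelALCHI (I : Interp) (T : ALCHITBox) : Prop :=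
  (∀ C D : ALCI, ALCHIAx.ci C D ∈ T → I.semA C ⊆ I.semA D) ∧
  (∀ ρ σ : Role, ALCHIAx.ri ρ σ ∈ T → I.rI ρ ⊆ I.rI σ)

/-- DL-Lite basic concepts: concept names and unqualified existential
restrictions `∃ρ` over (possibly inverse) roles. -/
inductive Basic : Type
  | atom (B : ℕ)
  | ex (ρ : Role)
  deriving DecidableEq

/-- Semantics of basic concepts. -/
def Interp.semB (I : Interp) : Basic → Set I.Dom
  | .atom B => I.cInt B
  | .ex ρ => {d | ∃ e, (d, e) ∈ I.rI ρ}

/-- DL-Lite_R axioms: positive and negative concept inclusions between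
basic concepts, and role inclusions. -/
inductive LiteAx : Type
  | pos (B₁ B₂ : Basic)
  | npos (B₁ B₂ : Basic)
  | ri (ρ σ : Role)

/-- A DL-Lite_R TBox is a finite list of axioms. -/
abbrev LiteTBox := List LiteAx

/-- `I` is a model of the DL-Lite_R TBox `T`. -/
def Interp.modelLite (I : Interp) (T : LiteTBox) : Prop :=
  (∀ B₁ B₂ : Basic, LiteAx.pos B₁ B₂ ∈ T → I.semB B₁ ⊆ I.semB B₂) ∧
  (∀ B₁ B₂ : Basic, LiteAx.npos B₁ B₂ ∈ T → I.semB B₁ ∩ I.semB B₂ = ∅) ∧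
  (∀ ρ σ : Role, LiteAx.ri ρ σ ∈ T → I.rI ρ ⊆ I.rI σ)

/-- `T ⊨ B₁ ⊑ B₂`. -/
def liteEntPos (T : LiteTBox) (B₁ B₂ : Basic) : Prop :=
  ∀ I : Interp, I.modelLite T → I.semB B₁ ⊆ I.semB B₂

/-- `T ⊨ B₁ ⊑ ¬B₂`. -/
def liteEntNeg (T : LiteTBox) (B₁ B₂ : Basic) : Prop :=
  ∀ I : Interp, I.modelLite T → I.semB B₁ ∩ I.semB B₂ = ∅

/-- `T ⊨ ρ ⊑ σ`. -/
def liteEntRI (T : LiteTBox) (ρ σ : Role) : Prop :=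
  ∀ I : Interp, I.modelLite T → I.rI ρ ⊆ I.rI σ

/-- `B` is satisfiable w.r.t. `T`. -/
def liteSat (T : LiteTBox) (B : Basic) : Prop :=
  ∃ I : Interp, I.modelLite T ∧ (I.semB B).Nonempty

/-- Concept names occurring in a basic concept. -/
def Basic.sigC : Basic → Set ℕ
  | .atom B => {B}
  | .ex _ => ∅

/-- Role names occurring in a basic concept. -/
def Basic.sigR : Basic → Set ℕ
  | .atom _ => ∅
  | .ex ρ => {ρ.name}

/-- Safeness of a DL-Lite_R TBox with closed predicates `(T, S_C)` where
`S_C` consists of the concept names `Sc` and the role names `Sr`. -/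
def LiteSafe (T : LiteTBox) (Sc Sr : Set ℕ) : Prop :=
  ¬ ∃ (B₁ B₂ : Basic) (ρ : Role),
      liteSat T B₁ ∧
      liteEntPos T B₁ (.ex ρ) ∧ liteEntPos T (.ex ρ.flip) B₂ ∧
      (∀ ρ' : Role, liteEntRI T ρ' ρ → B₁ ≠ .ex ρ') ∧
      (B₂.sigC ⊆ Sc ∧ B₂.sigR ⊆ Sr) ∧
      (∀ ρ' : Role, liteEntPos T B₁ (.ex ρ') → liteEntRI T ρ' ρ → ρ'.name ∉ Sr)

/-- `AtomRepl q q'` : `q'` is obtained from `q` by replacing one concept or role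
atom with an atom of the same kind (over the same variables). -/
inductive AtomRepl : FO → FO → Prop
  | capp (B B' x : ℕ) : AtomRepl (.capp B x) (.capp B' x)
  | rapp (r r' x y : ℕ) : AtomRepl (.rapp r x y) (.rapp r' x y)
  | neg {φ φ'} : AtomRepl φ φ' → AtomRepl (.neg φ) (.neg φ')
  | conjL {φ φ'} (ψ : FO) : AtomRepl φ φ' → AtomRepl (.conj φ ψ) (.conj φ' ψ)
  | conjR (φ : FO) {ψ ψ'} : AtomRepl ψ ψ' → AtomRepl (.conj φ ψ) (.conj φ ψ')
  | disjL {φ φ'} (ψ : FO) : AtomRepl φ φ' → AtomRepl (.disj φ ψ) (.disj φ' ψ)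
  | disjR (φ : FO) {ψ ψ'} : AtomRepl ψ ψ' → AtomRepl (.disj φ ψ) (.disj φ ψ')
  | ex (x : ℕ) {φ φ'} : AtomRepl φ φ' → AtomRepl (.ex x φ) (.ex x φ')

/-- A class of queries is canonical if it is closed under replacing a concept or
role atom with an atom of the same kind. -/
def Canonical (Q : Set FO) : Prop :=
  ∀ q ∈ Q, ∀ q' : FO, AtomRepl q q' → q' ∈ Q

/-- The reduct of `I` along renamings `f` of concept names and `g` of role names. -/
def Interp.pull (I : Interp) (f g : ℕ → ℕ) : Interp where
  Dom := I.Dom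
  dne := I.dne
  ind := I.ind
  ind_inj := I.ind_inj
  cInt n := I.cInt (f n)
  rInt n := I.rInt (g n)

/-- Renaming of the role name in a role. -/
def Role.rename (g : ℕ → ℕ) : Role → Role
  | .nm r => .nm (g r)
  | .inv r => .inv (g r)

/-- Renaming of the predicates in an ALCI concept. -/
def ALCI.rename (f g : ℕ → ℕ) : ALCI → ALCI
  | .atom B => .atom (f B)
  | .top => .top
  | .neg C => .neg (C.rename f g)
  | .conj C D => .conj (C.rename f g) (D.rename f g)
  | .ex ρ C => .ex (ρ.rename g) (C.rename f g)

/-- Renaming of the predicates in an ALCHI axiom. -/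
def ALCHIAx.rename (f g : ℕ → ℕ) : ALCHIAx → ALCHIAx
  | .ci C D => .ci (C.rename f g) (D.rename f g)
  | .ri ρ σ => .ri (ρ.rename g) (σ.rename g)

/-- Renaming of the predicates in a basic concept. -/
def Basic.rename (f g : ℕ → ℕ) : Basic → Basic
  | .atom B => .atom (f B)
  | .ex ρ => .ex (ρ.rename g)

/-- Renaming of the predicates in a DL-Lite axiom. -/
def LiteAx.rename (f g : ℕ → ℕ) : LiteAx → LiteAx
  | .pos B C => .pos (B.rename f g) (C.rename f g)
  | .npos B C => .npos (B.rename f g) (C.rename f g)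
  | .ri ρ σ => .ri (ρ.rename g) (σ.rename g)

/-- Renaming of the predicates in a first-order query. -/
def FO.rename (f g : ℕ → ℕ) : FO → FO
  | .eq x y => .eq x y
  | .capp B x => .capp (f B) x
  | .rapp r x y => .rapp (g r) x y
  | .neg φ => .neg (φ.rename f g)
  | .conj φ ψ => .conj (φ.rename f g) (ψ.rename f g)
  | .disj φ ψ => .disj (φ.rename f g) (ψ.rename f g)
  | .ex x φ => .ex x (φ.rename f g)

theorem Interp.rI_pull (I : Interp) (f g : ℕ → ℕ) (ρ : Role) :
    (I.pull f g).rI ρ = I.rI (ρ.rename g) := by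
  cases ρ <;> rfl

theorem Interp.semA_pull (I : Interp) (f g : ℕ → ℕ) (C : ALCI) :
    (I.pull f g).semA C = I.semA (C.rename f g) := by
  induction C with
  | atom B => rfl
  | top => rfl
  | neg C ih => exact congrArg (fun s : Set I.Dom => sᶜ) ih
  | conj C D ihC ihD => exact congrArg₂ (fun s t : Set I.Dom => s ∩ t) ihC ihD
  | ex ρ C ih =>
    exact congrArg₂ (fun (R : Set (I.Dom × I.Dom)) (s : Set I.Dom) =>
      {d | ∃ e, (d, e) ∈ R ∧ e ∈ s}) (I.rI_pull f g ρ) ih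

theorem Interp.semB_pull (I : Interp) (f g : ℕ → ℕ) (B : Basic) :
    (I.pull f g).semB B = I.semB (B.rename f g) := by
  cases B with
  | atom B => rfl
  | ex ρ =>
    exact congrArg (fun R : Set (I.Dom × I.Dom) => {d | ∃ e, (d, e) ∈ R}) (I.rI_pull f g ρ)

theorem Interp.evalFO_pull (I : Interp) (f g : ℕ → ℕ) (φ : FO) :
    ∀ v : ℕ → I.Dom, (I.pull f g).evalFO v φ ↔ I.evalFO v (φ.rename f g) := by
  induction φ with
  | eq x y => exact fun v => Iff.rfl
  | capp B x => exact fun v => Iff.rfl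
  | rapp r x y => exact fun v => Iff.rfl
  | neg φ ih => exact fun v => not_congr (ih v)
  | conj φ ψ ih₁ ih₂ => exact fun v => and_congr (ih₁ v) (ih₂ v)
  | disj φ ψ ih₁ ih₂ => exact fun v => or_congr (ih₁ v) (ih₂ v)
  | ex x φ ih => exact fun v => exists_congr fun d => ih (Function.update v x d)

theorem Interp.sat_pull (I : Interp) (f g : ℕ → ℕ) (q : FO) (xs as : List ℕ) :
    (I.pull f g).sat q xs as ↔ I.sat (q.rename f g) xs as :=
  exists_congr fun v => and_congr Iff.rfl (I.evalFO_pull f g q v)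

theorem FO.free_rename (f g : ℕ → ℕ) (φ : FO) : (φ.rename f g).free = φ.free := by
  induction φ <;> simp_all [FO.rename, FO.free]

theorem AtomRepl.reflTransGen_rename (f g : ℕ → ℕ) (φ : FO) :
    Relation.ReflTransGen AtomRepl φ (φ.rename f g) := by
  induction φ with
  | eq x y => exact .refl
  | capp B x => exact .single (.capp _ _ _)
  | rapp r x y => exact .single (.rapp _ _ _ _)
  | neg φ ih => exact ih.lift FO.neg fun _ _ => .neg
  | conj φ ψ ih₁ ih₂ =>
    exact (ih₁.lift (fun χ => FO.conj χ ψ) fun _ _ => .conjL ψ).trans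
      (ih₂.lift (fun χ => FO.conj (φ.rename f g) χ) fun _ _ => .conjR _)
  | disj φ ψ ih₁ ih₂ =>
    exact (ih₁.lift (fun χ => FO.disj χ ψ) fun _ _ => .disjL ψ).trans
      (ih₂.lift (fun χ => FO.disj (φ.rename f g) χ) fun _ _ => .disjR _)
  | ex x φ ih => exact ih.lift (FO.ex x) fun _ _ => .ex x

theorem Canonical.rename_mem {Q : Set FO} (hQ : Canonical Q) (f g : ℕ → ℕ) {q : FO}
    (hq : q ∈ Q) : q.rename f g ∈ Q := by
  have h := AtomRepl.reflTransGen_rename f g q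
  generalize q.rename f g = q' at h
  induction h with
  | refl => exact hq
  | tail _ h ih => exact hQ _ ih _ h

/-- Every predicate in `Sc`, `Sr` is contained in its renaming. -/
def Interp.inclRename (I : Interp) (f g : ℕ → ℕ) (Sc Sr : Set ℕ) : Prop :=
  (∀ B ∈ Sc, I.cInt B ⊆ I.cInt (f B)) ∧ (∀ r ∈ Sr, I.rInt r ⊆ I.rInt (g r))

/-- The renamed DL-Lite TBox together with inclusions of the listed predicates in their
renamings. -/
def LiteTBox.rename (f g : ℕ → ℕ) (cs rs : List ℕ) (T : LiteTBox) : LiteTBox :=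
  T.map (LiteAx.rename f g) ++
    (cs.map (fun B => LiteAx.pos (.atom B) (.atom (f B))) ++
      rs.map (fun r => LiteAx.ri (.nm r) (.nm (g r))))

/-- The renamed ALCHI TBox together with inclusions of the listed predicates in their
renamings. -/
def ALCHITBox.rename (f g : ℕ → ℕ) (cs rs : List ℕ) (T : ALCHITBox) : ALCHITBox :=
  T.map (ALCHIAx.rename f g) ++
    (cs.map (fun B => ALCHIAx.ci (.atom B) (.atom (f B))) ++
      rs.map (fun r => ALCHIAx.ri (.nm r) (.nm (g r))))

/-- Truth of a single DL-Lite axiom. -/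
def Interp.holdsLite (I : Interp) : LiteAx → Prop
  | .pos B C => I.semB B ⊆ I.semB C
  | .npos B C => I.semB B ∩ I.semB C = ∅
  | .ri ρ σ => I.rI ρ ⊆ I.rI σ

/-- Truth of a single ALCHI axiom. -/
def Interp.holdsALCHI (I : Interp) : ALCHIAx → Prop
  | .ci C D => I.semA C ⊆ I.semA D
  | .ri ρ σ => I.rI ρ ⊆ I.rI σ

theorem Interp.modelLite_iff (I : Interp) (T : LiteTBox) :
    I.modelLite T ↔ ∀ α ∈ T, I.holdsLite α := by
  refine ⟨fun h α hα => ?_, fun h => ⟨fun _ _ hm => h _ hm, fun _ _ hm => h _ hm,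
    fun _ _ hm => h _ hm⟩⟩
  cases α with
  | pos B C => exact h.1 _ _ hα
  | npos B C => exact h.2.1 _ _ hα
  | ri ρ σ => exact h.2.2 _ _ hα

theorem Interp.modelALCHI_iff (I : Interp) (T : ALCHITBox) :
    I.modelALCHI T ↔ ∀ α ∈ T, I.holdsALCHI α := by
  refine ⟨fun h α hα => ?_, fun h => ⟨fun _ _ hm => h _ hm, fun _ _ hm => h _ hm⟩⟩
  cases α with
  | ci C D => exact h.1 _ _ hα
  | ri ρ σ => exact h.2 _ _ hα

theorem Interp.holdsLite_pull (I : Interp) (f g : ℕ → ℕ) (α : LiteAx) :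
    (I.pull f g).holdsLite α ↔ I.holdsLite (α.rename f g) := by
  cases α <;> simp only [holdsLite, LiteAx.rename, semB_pull, rI_pull] <;> rfl

theorem Interp.holdsALCHI_pull (I : Interp) (f g : ℕ → ℕ) (α : ALCHIAx) :
    (I.pull f g).holdsALCHI α ↔ I.holdsALCHI (α.rename f g) := by
  cases α <;> simp only [holdsALCHI, ALCHIAx.rename, semA_pull, rI_pull] <;> rfl

theorem Interp.modelLite_rename (I : Interp) (f g : ℕ → ℕ) (cs rs : List ℕ) (T : LiteTBox) :
    I.modelLite (LiteTBox.rename f g cs rs T) ↔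
      (I.pull f g).modelLite T ∧ I.inclRename f g {B | B ∈ cs} {r | r ∈ rs} := by
  simp only [modelLite_iff, holdsLite_pull, LiteTBox.rename, List.forall_mem_append,
    List.forall_mem_map]
  rfl

theorem Interp.modelALCHI_rename (I : Interp) (f g : ℕ → ℕ) (cs rs : List ℕ)
    (T : ALCHITBox) :
    I.modelALCHI (ALCHITBox.rename f g cs rs T) ↔
      (I.pull f g).modelALCHI T ∧ I.inclRename f g {B | B ∈ cs} {r | r ∈ rs} := by
  simp only [modelALCHI_iff, holdsALCHI_pull, ALCHITBox.rename, List.forall_mem_append,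
    List.forall_mem_map]
  rfl

open Classical in
/-- Shift all names outside `S` by `k`. -/
noncomputable def shiftOutside (S : Set ℕ) (k n : ℕ) : ℕ := if n ∈ S then n else n + k

theorem shiftOutside_of_mem {S : Set ℕ} {n : ℕ} (h : n ∈ S) (k : ℕ) :
    shiftOutside S k n = n := if_pos h

theorem shiftOutside_of_notMem {S : Set ℕ} {n : ℕ} (h : n ∉ S) (k : ℕ) :
    shiftOutside S k n = n + k := if_neg h

open Classical in
/-- Interpret the predicates in `Sc` and `Sr` exactly as asserted in `A`, and all other
predicates as `I` interprets them before shifting by `k`. -/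
noncomputable def Interp.close (I : Interp) (A : ABox) (Sc Sr : Set ℕ) (k : ℕ) : Interp where
  Dom := I.Dom
  dne := I.dne
  ind := I.ind
  ind_inj := I.ind_inj
  cInt n := if n ∈ Sc then {d | ∃ a, I.ind a = some d ∧ (n, a) ∈ A.ca} else I.cInt (n - k)
  rInt n := if n ∈ Sr then
      {p | ∃ a b, I.ind a = some p.1 ∧ I.ind b = some p.2 ∧ (n, a, b) ∈ A.ra}
    else I.rInt (n - k)

section close

variable {I : Interp} {A : ABox} {Sc Sr Tc Tr : Set ℕ} {k : ℕ}

theorem Interp.cInt_close_of_mem {B : ℕ} (hB : B ∈ Sc) :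
    (I.close A Sc Sr k).cInt B = {d | ∃ a, I.ind a = some d ∧ (B, a) ∈ A.ca} := if_pos hB

theorem Interp.rInt_close_of_mem {r : ℕ} (hr : r ∈ Sr) :
    (I.close A Sc Sr k).rInt r =
      {p | ∃ a b, I.ind a = some p.1 ∧ I.ind b = some p.2 ∧ (r, a, b) ∈ A.ra} := if_pos hr

theorem Interp.respects_close : (I.close A Sc Sr k).respects A Sc Sr := by
  refine ⟨fun B hB d => ?_, fun r hr d e => ?_⟩
  · rw [cInt_close_of_mem hB]; rfl
  · rw [rInt_close_of_mem hr]; rfl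

theorem Interp.modelA.close (hA : I.modelA A) (hu : A.usesOnly Sc Sr) :
    (I.close A Sc Sr k).modelA A := by
  refine ⟨fun p hp => ?_, fun t ht => ?_⟩
  · obtain ⟨d, hd, -⟩ := hA.1 p hp
    refine ⟨d, hd, ?_⟩
    rw [cInt_close_of_mem (hu.1 p hp)]
    exact ⟨p.2, hd, hp⟩
  · obtain ⟨d, e, hd, he, -⟩ := hA.2 t ht
    refine ⟨d, e, hd, he, ?_⟩
    rw [rInt_close_of_mem (hu.2 t ht)]
    exact ⟨t.2.1, t.2.2, hd, he, ht⟩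

theorem Interp.cInt_close_shiftOutside (hI : I.respects A Tc Tr) (hc : Tc ⊆ Sc)
    (hk : ∀ n ∈ Sc, n < k) (n : ℕ) :
    (I.close A Sc Sr k).cInt (shiftOutside Tc k n) = I.cInt n := by
  by_cases hn : n ∈ Tc
  · rw [shiftOutside_of_mem hn, cInt_close_of_mem (hc hn)]
    exact Set.ext fun d => (hI.1 n hn d).symm
  · have hmem : n + k ∉ Sc := fun h => by have := hk _ h; omega
    rw [shiftOutside_of_notMem hn]
    exact (if_neg hmem).trans (congrArg I.cInt (Nat.add_sub_cancel n k))

theorem Interp.rInt_close_shiftOutside (hI : I.respects A Tc Tr) (hr : Tr ⊆ Sr)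
    (hk : ∀ n ∈ Sr, n < k) (n : ℕ) :
    (I.close A Sc Sr k).rInt (shiftOutside Tr k n) = I.rInt n := by
  by_cases hn : n ∈ Tr
  · rw [shiftOutside_of_mem hn, rInt_close_of_mem (hr hn)]
    exact Set.ext fun p => (hI.2 n hn p.1 p.2).symm
  · have hmem : n + k ∉ Sr := fun h => by have := hk _ h; omega
    rw [shiftOutside_of_notMem hn]
    exact (if_neg hmem).trans (congrArg I.rInt (Nat.add_sub_cancel n k))

theorem Interp.pull_close (hI : I.respects A Tc Tr) (hc : Tc ⊆ Sc) (hr : Tr ⊆ Sr)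
    (hkc : ∀ n ∈ Sc, n < k) (hkr : ∀ n ∈ Sr, n < k) :
    (I.close A Sc Sr k).pull (shiftOutside Tc k) (shiftOutside Tr k) = I := by
  have h₁ : (fun n => (I.close A Sc Sr k).cInt (shiftOutside Tc k n)) = I.cInt :=
    funext (cInt_close_shiftOutside hI hc hkc)
  have h₂ : (fun n => (I.close A Sc Sr k).rInt (shiftOutside Tr k n)) = I.rInt :=
    funext (rInt_close_shiftOutside hI hr hkr)
  exact congrArg₂ (Interp.mk I.Dom I.dne I.ind I.ind_inj) h₁ h₂

theorem Interp.inclRename_close (hA : I.modelA A) (hI : I.respects A Tc Tr) (hc : Tc ⊆ Sc)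
    (hr : Tr ⊆ Sr) (hkc : ∀ n ∈ Sc, n < k) (hkr : ∀ n ∈ Sr, n < k) :
    (I.close A Sc Sr k).inclRename (shiftOutside Tc k) (shiftOutside Tr k) Sc Sr := by
  refine ⟨fun B hB => ?_, fun r hrS => ?_⟩
  · rw [cInt_close_shiftOutside hI hc hkc, cInt_close_of_mem hB]
    rintro d ⟨a, ha, hBa⟩
    obtain ⟨d', hd', hmem⟩ := hA.1 _ hBa
    cases Option.some.inj (ha.symm.trans hd')
    exact hmem
  · rw [rInt_close_shiftOutside hI hr hkr, rInt_close_of_mem hrS]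
    rintro ⟨d, e⟩ ⟨a, b, ha, hb, hab⟩
    obtain ⟨d', e', hd', he', hmem⟩ := hA.2 _ hab
    cases Option.some.inj (ha.symm.trans hd')
    cases Option.some.inj (hb.symm.trans he')
    exact hmem

end close

theorem Interp.modelA.pull {I : Interp} {A : ABox} {f g : ℕ → ℕ} {Sc Sr : Set ℕ}
    (hA : I.modelA A) (hu : A.usesOnly Sc Sr) (h : I.inclRename f g Sc Sr) :
    (I.pull f g).modelA A := by
  refine ⟨fun p hp => ?_, fun t ht => ?_⟩
  · obtain ⟨d, hd, hmem⟩ := hA.1 p hp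
    exact ⟨d, hd, h.1 _ (hu.1 p hp) hmem⟩
  · obtain ⟨d, e, hd, he, hmem⟩ := hA.2 t ht
    exact ⟨d, e, hd, he, h.2 _ (hu.2 t ht) hmem⟩

theorem Interp.respects.pull_shiftOutside {I : Interp} {A : ABox} {Sc Sr Tc Tr : Set ℕ}
    (h : I.respects A Sc Sr) (hc : Tc ⊆ Sc) (hr : Tr ⊆ Sr) (k : ℕ) :
    (I.pull (shiftOutside Tc k) (shiftOutside Tr k)).respects A Tc Tr := by
  refine ⟨fun B hB d => ?_, fun r hrT d e => ?_⟩
  · change d ∈ I.cInt (shiftOutside Tc k B) ↔ _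
    rw [shiftOutside_of_mem hB]
    exact h.1 B (hc hB) d
  · change (d, e) ∈ I.rInt (shiftOutside Tr k r) ↔ _
    rw [shiftOutside_of_mem hrT]
    exact h.2 r (hr hrT) d e

/-- Closing all ABox predicates does not change the certain answers, provided that the
predicates that were not closed before are shifted in the TBox and the query and are
contained in their shifted copies. -/
theorem certAns_shiftOutside_iff {mod mod' : Interp → Prop} {Sc Sr Tc Tr : Set ℕ} {k : ℕ}
    (hc : Tc ⊆ Sc) (hr : Tr ⊆ Sr) (hkc : ∀ n ∈ Sc, n < k) (hkr : ∀ n ∈ Sr, n < k)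
    (hmod : ∀ I : Interp, mod' I ↔
      mod (I.pull (shiftOutside Tc k) (shiftOutside Tr k)) ∧
        I.inclRename (shiftOutside Tc k) (shiftOutside Tr k) Sc Sr)
    {A : ABox} (hu : A.usesOnly Sc Sr) (q : FO) (xs as : List ℕ) :
    certAns mod Tc Tr A q xs as ↔
      certAns mod' Sc Sr A (q.rename (shiftOutside Tc k) (shiftOutside Tr k)) xs as := by
  constructor
  · intro h I hI hA hresp
    obtain ⟨hm, hincl⟩ := (hmod I).1 hI
    exact (I.sat_pull _ _ q xs as).1
      (h _ hm (hA.pull hu hincl) (hresp.pull_shiftOutside hc hr k))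
  · intro h I hI hA hresp
    have hp := Interp.pull_close hresp hc hr hkc hkr
    have hs := h (I.close A Sc Sr k)
      ((hmod _).2 ⟨hp.symm ▸ hI, Interp.inclRename_close hA hresp hc hr hkc hkr⟩)
      (hA.close hu) Interp.respects_close
    rw [← Interp.sat_pull, hp] at hs
    exact hs

/-- Let `L` be DL-Lite_R or ALCHI and `Q` a canonical class of
UCQs.  Then every OMQC `(T, S_A, S_C, q)` with `T` an `L` TBox, `S_C ⊆ S_A` and
`q ∈ Q` is equivalent to an OMQC `(T', S_A, S_A, q')` with `T'` an `L` TBox and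
`q' ∈ Q` (equivalent: same certain answers on all `S_A`-ABoxes).
The first conjunct treats `L = DL-Lite_R`, the second `L = ALCHI`. -/
theorem statement_1 (Q : Set FO) (hQ : ∀ q ∈ Q, IsUCQ q) (hcan : Canonical Q)
    (Sac Sar Scc Scr : Set ℕ)
    (hfinA : Sac.Finite ∧ Sar.Finite) (hsub : Scc ⊆ Sac ∧ Scr ⊆ Sar)
    (xs : List ℕ) :
    (∀ T : LiteTBox, ∀ q ∈ Q, FO.free q ⊆ {x | x ∈ xs} →
      ∃ T' : LiteTBox, ∃ q' ∈ Q, FO.free q' ⊆ {x | x ∈ xs} ∧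
        ∀ A : ABox, A.Fin → A.usesOnly Sac Sar →
          ∀ as : List ℕ, as.length = xs.length → (∀ a ∈ as, a ∈ A.ind) →
            (certAns (fun I => I.modelLite T) Scc Scr A q xs as ↔
              certAns (fun I => I.modelLite T') Sac Sar A q' xs as)) ∧
    (∀ T : ALCHITBox, ∀ q ∈ Q, FO.free q ⊆ {x | x ∈ xs} →
      ∃ T' : ALCHITBox, ∃ q' ∈ Q, FO.free q' ⊆ {x | x ∈ xs} ∧
        ∀ A : ABox, A.Fin → A.usesOnly Sac Sar →
          ∀ as : List ℕ, as.length = xs.length → (∀ a ∈ as, a ∈ A.ind) →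
            (certAns (fun I => I.modelALCHI T) Scc Scr A q xs as ↔
              certAns (fun I => I.modelALCHI T') Sac Sar A q' xs as)) := by
  obtain ⟨hfc, hfr⟩ := hfinA
  obtain ⟨hc, hr⟩ := hsub
  obtain ⟨k, hk⟩ := (hfc.union hfr).bddAbove
  have hkc : ∀ n ∈ Sac, n < k + 1 := fun n hn => Nat.lt_succ_of_le (hk (Or.inl hn))
  have hkr : ∀ n ∈ Sar, n < k + 1 := fun n hn => Nat.lt_succ_of_le (hk (Or.inr hn))
  have hcs : {B | B ∈ hfc.toFinset.toList} = Sac := by ext; simp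
  have hrs : {r | r ∈ hfr.toFinset.toList} = Sar := by ext; simp
  set f := shiftOutside Scc (k + 1)
  set g := shiftOutside Scr (k + 1)
  refine ⟨fun T q hq hfree => ⟨LiteTBox.rename f g hfc.toFinset.toList hfr.toFinset.toList T,
      q.rename f g, hcan.rename_mem f g hq, (FO.free_rename f g q).trans_subset hfree,
      fun A _ hu as _ _ => certAns_shiftOutside_iff hc hr hkc hkr (fun I => ?_) hu q xs as⟩,
    fun T q hq hfree => ⟨ALCHITBox.rename f g hfc.toFinset.toList hfr.toFinset.toList T,
      q.rename f g, hcan.rename_mem f g hq, (FO.free_rename f g q).trans_subset hfree,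
      fun A _ hu as _ _ => certAns_shiftOutside_iff hc hr hkc hkr (fun I => ?_) hu q xs as⟩⟩
  · rw [Interp.modelLite_rename, hcs, hrs]
  · rw [Interp.modelALCHI_rename, hcs, hrs]


end DL
end

section
/- Let Q = (T, Σ_A, Σ_C, q(x⃗)) be an OMQC with T an ALCHI TBox and q a CQ, and let q'(x⃗) be a domain-independent first-order formula whose predicates all belong to Σ_C. If Q is FO-rewritable and ABox consistency is FO-rewritable for (T, Σ_A, Σ_C), then the OMQC Q' = (T, Σ_A, Σ_C, q ∧ q') is FO-rewritable. -/
namespace DL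

/-- Active-domain evaluation of a first-order query over (the interpretation
`I_A` corresponding to) an ABox: quantifiers range over `Ind(A)`. -/
def ABox.evalFO (A : ABox) : (ℕ → ℕ) → FO → Prop
  | v, .eq x y => v x = v y
  | v, .capp B x => (B, v x) ∈ A.ca
  | v, .rapp r x y => (r, v x, v y) ∈ A.ra
  | v, .neg φ => ¬ A.evalFO v φ
  | v, .conj φ ψ => A.evalFO v φ ∧ A.evalFO v ψ
  | v, .disj φ ψ => A.evalFO v φ ∨ A.evalFO v ψ
  | v, .ex x φ => ∃ a ∈ A.ind, A.evalFO (Function.update v x a) φ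

/-- `I_A ⊨ p(as)` where `xs` are the answer variables of `p`. -/
def ABox.satFO (A : ABox) (p : FO) (xs as : List ℕ) : Prop :=
  ∃ v : ℕ → ℕ, (∀ pr ∈ List.zip xs as, v pr.1 = pr.2) ∧ A.evalFO v p

/-- FO-rewritability of an ontology-mediated query whose certain answers are
given by `certain`, over the admissible ABoxes: there is a first-order formula
`p` with free variables among the answer variables `xs` such that for all
admissible ABoxes `A` and all tuples `as` from `Ind(A)`:
`I_A ⊨ p(as)` iff `as` is a certain answer. -/
def FORewritable (certain : ABox → List ℕ → Prop) (admissible : ABox → Prop)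
    (xs : List ℕ) : Prop :=
  ∃ p : FO, p.free ⊆ {x | x ∈ xs} ∧
    ∀ A : ABox, admissible A →
      ∀ as : List ℕ, as.length = xs.length → (∀ a ∈ as, a ∈ A.ind) →
        (A.satFO p xs as ↔ certain A as)

/-- Concept names occurring in a first-order query. -/
def FO.cnames : FO → Set ℕ
  | .eq _ _ => ∅
  | .capp B _ => {B}
  | .rapp _ _ _ => ∅
  | .neg φ => φ.cnames
  | .conj φ ψ => φ.cnames ∪ ψ.cnames
  | .disj φ ψ => φ.cnames ∪ ψ.cnames
  | .ex _ φ => φ.cnames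

/-- Role names occurring in a first-order query. -/
def FO.rnames : FO → Set ℕ
  | .eq _ _ => ∅
  | .capp _ _ => ∅
  | .rapp r _ _ => {r}
  | .neg φ => φ.rnames
  | .conj φ ψ => φ.rnames ∪ ψ.rnames
  | .disj φ ψ => φ.rnames ∪ ψ.rnames
  | .ex _ φ => φ.rnames

/-- `q` is domain-independent: whenever `I` is (isomorphic via `e` to) a
sub-interpretation of `J` with `Δ^I ⊆ Δ^J` and `P^I = P^J` for every predicate
`P` occurring in `q`, then for every assignment into `Δ^I`, `q` has the same
truth value in `I` and in `J`. -/
def DomIndep (q : FO) : Prop :=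
  ∀ (I J : Interp) (e : I.Dom → J.Dom), Function.Injective e →
    (∀ B ∈ q.cnames,
      (∀ d : I.Dom, d ∈ I.cInt B ↔ e d ∈ J.cInt B) ∧
      (∀ d' ∈ J.cInt B, ∃ d : I.Dom, e d = d')) →
    (∀ r ∈ q.rnames,
      (∀ d₁ d₂ : I.Dom, (d₁, d₂) ∈ I.rInt r ↔ (e d₁, e d₂) ∈ J.rInt r) ∧
      (∀ p ∈ J.rInt r, ∃ d₁ d₂ : I.Dom, e d₁ = p.1 ∧ e d₂ = p.2)) →
    ∀ v : ℕ → I.Dom, (I.evalFO v q ↔ J.evalFO (e ∘ v) q)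

/-- ABox consistency w.r.t. `(T, S_A, S_C)` is FO-rewritable. -/
def ConsFORewritable (mod : Interp → Prop) (Sc Sr : Set ℕ)
    (admissible : ABox → Prop) : Prop :=
  ∃ s : FO, s.free = ∅ ∧
    ∀ A : ABox, admissible A →
      ((∀ v : ℕ → ℕ, A.evalFO v s) ↔ consistentW mod Sc Sr A)

theorem Interp.evalFO_congr (I : Interp) (φ : FO) {v w : ℕ → I.Dom}
    (h : ∀ x ∈ φ.free, v x = w x) : I.evalFO v φ ↔ I.evalFO w φ := by
  induction φ generalizing v w with
  | eq x y => simp [Interp.evalFO, h x (by simp [FO.free]), h y (by simp [FO.free])]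
  | capp B x => simp [Interp.evalFO, h x (by simp [FO.free])]
  | rapp r x y => simp [Interp.evalFO, h x (by simp [FO.free]), h y (by simp [FO.free])]
  | neg φ ih => exact not_congr (ih h)
  | conj φ ψ ih₁ ih₂ =>
    exact and_congr (ih₁ fun x hx => h x (Or.inl hx)) (ih₂ fun x hx => h x (Or.inr hx))
  | disj φ ψ ih₁ ih₂ =>
    exact or_congr (ih₁ fun x hx => h x (Or.inl hx)) (ih₂ fun x hx => h x (Or.inr hx))
  | ex x φ ih =>
    refine exists_congr fun d => ih fun y hy => ?_
    by_cases hyx : y = x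
    · subst hyx; simp
    · simpa [hyx] using h y ⟨hy, hyx⟩

theorem ABox.evalFO_congr (A : ABox) (φ : FO) {v w : ℕ → ℕ}
    (h : ∀ x ∈ φ.free, v x = w x) : A.evalFO v φ ↔ A.evalFO w φ := by
  induction φ generalizing v w with
  | eq x y => simp [ABox.evalFO, h x (by simp [FO.free]), h y (by simp [FO.free])]
  | capp B x => simp [ABox.evalFO, h x (by simp [FO.free])]
  | rapp r x y => simp [ABox.evalFO, h x (by simp [FO.free]), h y (by simp [FO.free])]
  | neg φ ih => exact not_congr (ih h)
  | conj φ ψ ih₁ ih₂ =>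
    exact and_congr (ih₁ fun x hx => h x (Or.inl hx)) (ih₂ fun x hx => h x (Or.inr hx))
  | disj φ ψ ih₁ ih₂ =>
    exact or_congr (ih₁ fun x hx => h x (Or.inl hx)) (ih₂ fun x hx => h x (Or.inr hx))
  | ex x φ ih =>
    refine exists_congr fun d => and_congr_right fun _ => ih fun y hy => ?_
    by_cases hyx : y = x
    · subst hyx; simp
    · simpa [hyx] using h y ⟨hy, hyx⟩

/-- The interpretation `I_A` of an ABox with at least one individual name. -/
noncomputable def ABox.toInterp (A : ABox) (h : A.ind.Nonempty) : Interp where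
  Dom := A.ind
  dne := h.to_subtype
  ind a := open Classical in if ha : a ∈ A.ind then some ⟨a, ha⟩ else none
  ind_inj a b d hda hdb := by
    split_ifs at hda hdb
    cases hda
    cases hdb
    rfl
  cInt B := {a | (B, a.1) ∈ A.ca}
  rInt r := {p | (r, p.1.1, p.2.1) ∈ A.ra}

theorem ABox.evalFO_toInterp (A : ABox) (h : A.ind.Nonempty) (φ : FO) (v : ℕ → A.ind) :
    (A.toInterp h).evalFO v φ ↔ A.evalFO (fun x => (v x).1) φ := by
  induction φ generalizing v with
  | eq x y => exact Subtype.ext_iff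
  | capp B x => exact Iff.rfl
  | rapp r x y => exact Iff.rfl
  | neg φ ih => exact not_congr (ih v)
  | conj φ ψ ih₁ ih₂ => exact and_congr (ih₁ v) (ih₂ v)
  | disj φ ψ ih₁ ih₂ => exact or_congr (ih₁ v) (ih₂ v)
  | ex x φ ih =>
    have key (d : A.ind) : (fun y => (Function.update v x d y).1) =
        Function.update (fun y => (v y).1) x d.1 := by
      funext y
      by_cases hyx : y = x
      · subst hyx; simp
      · simp [hyx]
    constructor
    · rintro ⟨d, hd⟩
      exact ⟨d.1, d.2, key d ▸ (ih _).1 hd⟩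
    · rintro ⟨a, ha, hd⟩
      exact ⟨⟨a, ha⟩, (ih (Function.update v x ⟨a, ha⟩)).2 (key ⟨a, ha⟩ ▸ hd)⟩

theorem Interp.modelA.exists_ind {I : Interp} {A : ABox} (h : I.modelA A) {a : ℕ}
    (ha : a ∈ A.ind) : ∃ d, I.ind a = some d := by
  rcases ha with ⟨p, hp, rfl⟩ | ⟨t, ht, rfl | rfl⟩
  · obtain ⟨d, hd, -⟩ := h.1 p hp
    exact ⟨d, hd⟩
  · obtain ⟨d, e, hd, -, -⟩ := h.2 t ht
    exact ⟨d, hd⟩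
  · obtain ⟨d, e, -, he, -⟩ := h.2 t ht
    exact ⟨e, he⟩

/-- A domain-independent query over closed predicates has the same truth value in the ABox
and in every model of the ABox that respects the closed predicates. -/
theorem DomIndep.evalFO_iff {q : FO} (hq : DomIndep q) {Sc Sr : Set ℕ} (hc : q.cnames ⊆ Sc)
    (hr : q.rnames ⊆ Sr) {I : Interp} {A : ABox} (hresp : I.respects A Sc Sr)
    (hne : A.ind.Nonempty) (e : A.ind → I.Dom) (he : ∀ a, I.ind a.1 = some (e a))
    (v : ℕ → A.ind) : A.evalFO (fun x => (v x).1) q ↔ I.evalFO (e ∘ v) q := by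
  have he_eq {a : ℕ} {b : A.ind} (h : I.ind a = some (e b)) : a = b.1 :=
    I.ind_inj _ _ _ h (he b)
  have hinj : Function.Injective e := fun a b hab => Subtype.ext (he_eq (hab ▸ he a))
  have hsurj {a : ℕ} {d : I.Dom} (ha : a ∈ A.ind) (hd : I.ind a = some d) :
      e ⟨a, ha⟩ = d := Option.some_injective _ ((he ⟨a, ha⟩).symm.trans hd)
  rw [← A.evalFO_toInterp hne]
  refine hq (A.toInterp hne) I e hinj (fun B hB => ⟨fun d => ?_, fun d hd => ?_⟩)
    (fun r hrn => ⟨fun d₁ d₂ => ?_, fun p hp => ?_⟩) v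
  · rw [hresp.1 B (hc hB)]
    constructor
    · intro h
      exact ⟨d.1, he d, h⟩
    · rintro ⟨a, ha, h⟩
      rw [he_eq ha] at h
      exact h
  · obtain ⟨a, ha, h⟩ := (hresp.1 B (hc hB) d).1 hd
    exact ⟨⟨a, Or.inl ⟨_, h, rfl⟩⟩, hsurj _ ha⟩
  · rw [hresp.2 r (hr hrn)]
    constructor
    · intro h
      exact ⟨d₁.1, d₂.1, he d₁, he d₂, h⟩
    · rintro ⟨a, b, ha, hb, h⟩
      rw [he_eq ha, he_eq hb] at h
      exact h
  · obtain ⟨a, b, ha, hb, h⟩ := (hresp.2 r (hr hrn) p.1 p.2).1 hp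
    exact ⟨⟨a, Or.inr ⟨_, h, Or.inl rfl⟩⟩, ⟨b, Or.inr ⟨_, h, Or.inr rfl⟩⟩,
      hsurj _ ha, hsurj _ hb⟩

theorem exists_zip_assignment {xs as : List ℕ} (hxs : xs.Nodup) :
    ∃ v : ℕ → ℕ, ∀ p ∈ List.zip xs as, v p.1 = p.2 := by
  refine ⟨fun x => as.getD (xs.idxOf x) 0, fun p hp => ?_⟩
  obtain ⟨i, hi, rfl⟩ := List.mem_iff_getElem.1 hp
  rw [List.length_zip, lt_min_iff] at hi
  simp [List.getElem_zip, hxs.idxOf_getElem, hi.2]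

theorem exists_mem_zip {xs as : List ℕ} (hlen : as.length = xs.length) {x : ℕ} (hx : x ∈ xs) :
    ∃ a ∈ as, (x, a) ∈ List.zip xs as := by
  obtain ⟨i, hi, rfl⟩ := List.mem_iff_getElem.1 hx
  refine ⟨as[i], List.getElem_mem _, List.mem_iff_getElem.2 ⟨i, ?_, ?_⟩⟩
  · simp [hlen, hi]
  · simp

theorem ABox.satFO_iff {A : ABox} {p : FO} {xs as : List ℕ} (hp : p.free ⊆ {x | x ∈ xs})
    (hlen : as.length = xs.length) {v : ℕ → ℕ} (hv : ∀ pr ∈ List.zip xs as, v pr.1 = pr.2) :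
    A.satFO p xs as ↔ A.evalFO v p := by
  refine ⟨?_, fun h => ⟨v, hv, h⟩⟩
  rintro ⟨w, hw, h⟩
  refine (A.evalFO_congr p fun x hx => ?_).1 h
  obtain ⟨a, -, ha⟩ := exists_mem_zip hlen (hp hx)
  exact (hw _ ha).trans (hv _ ha).symm

/-- To rewrite a query it suffices to find a formula that is correct on ABoxes with at least one
individual name, since there is only one other ABox. -/
theorem FORewritable.of_nonempty {certain : ABox → List ℕ → Prop} {admissible : ABox → Prop}
    {xs : List ℕ} (p : FO) (hp : p.free ⊆ {x | x ∈ xs})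
    (h : ∀ A, admissible A → A.ind.Nonempty → ∀ as : List ℕ, as.length = xs.length →
      (∀ a ∈ as, a ∈ A.ind) → (A.satFO p xs as ↔ certain A as)) :
    FORewritable certain admissible xs := by
  have hne (A : ABox) (v : ℕ → ℕ) : A.evalFO v (.ex 0 (.eq 0 0)) ↔ A.ind.Nonempty := by
    simp [ABox.evalFO, Set.Nonempty]
  have hempty {A : ABox} (hA : ¬ A.ind.Nonempty) {as : List ℕ} (has : ∀ a ∈ as, a ∈ A.ind) :
      A = ⟨∅, ∅⟩ ∧ as = [] := by
    constructor
    · obtain ⟨ca, ra⟩ := A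
      congr 1
      · exact Set.eq_empty_of_forall_notMem fun p hp => hA ⟨p.2, Or.inl ⟨p, hp, rfl⟩⟩
      · exact Set.eq_empty_of_forall_notMem fun t ht =>
          hA ⟨t.2.1, Or.inr ⟨t, ht, Or.inl rfl⟩⟩
    · exact List.eq_nil_iff_forall_not_mem.2 fun a ha => hA ⟨a, has a ha⟩
  by_cases hE : certain ⟨∅, ∅⟩ []
  · refine ⟨.disj p (.neg (.ex 0 (.eq 0 0))), by simpa [FO.free] using hp,
      fun A hA as hlen has => ?_⟩
    by_cases hAne : A.ind.Nonempty
    · rw [← h A hA hAne as hlen has]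
      refine exists_congr fun v => and_congr_right fun _ => or_iff_left ?_
      exact not_not_intro ((hne A v).2 hAne)
    · obtain ⟨rfl, rfl⟩ := hempty hAne has
      exact iff_of_true ⟨id, by simp, Or.inr fun hc => hAne ((hne _ _).1 hc)⟩ hE
  · refine ⟨.conj p (.ex 0 (.eq 0 0)), by simpa [FO.free] using hp,
      fun A hA as hlen has => ?_⟩
    by_cases hAne : A.ind.Nonempty
    · rw [← h A hA hAne as hlen has]
      exact exists_congr fun v => and_congr_right fun _ => and_iff_left ((hne A v).2 hAne)
    · obtain ⟨rfl, rfl⟩ := hempty hAne has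
      refine iff_of_false ?_ hE
      rintro ⟨v, -, -, hc⟩
      exact hAne ((hne _ _).1 hc)

/-- In a model respecting the closed predicates, a domain-independent conjunct over closed
predicates can be evaluated in the ABox instead. -/
theorem Interp.sat_conj_iff {q q' : FO} {xs as : List ℕ} {Sc Sr : Set ℕ} {I : Interp} {A : ABox}
    (hfree : q'.free ⊆ {x | x ∈ xs}) (hdi : DomIndep q') (hc : q'.cnames ⊆ Sc)
    (hr : q'.rnames ⊆ Sr) (hA : I.modelA A) (hresp : I.respects A Sc Sr)
    (hne : A.ind.Nonempty) (hlen : as.length = xs.length) (has : ∀ a ∈ as, a ∈ A.ind)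
    {v : ℕ → ℕ} (hv : ∀ pr ∈ List.zip xs as, v pr.1 = pr.2) :
    I.sat (.conj q q') xs as ↔ I.sat q xs as ∧ A.evalFO v q' := by
  classical
  choose e he using fun a : A.ind => hA.exists_ind a.2
  let u : ℕ → A.ind := fun x => if h : v x ∈ A.ind then ⟨v x, h⟩ else ⟨hne.some, hne.some_mem⟩
  have hu {x : ℕ} (hx : x ∈ xs) : (u x).1 = v x := by
    obtain ⟨a, ha, hxa⟩ := exists_mem_zip hlen hx
    have : v x ∈ A.ind := hv _ hxa ▸ has a ha
    simp [u, this]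
  have hAu : A.evalFO v q' ↔ A.evalFO (fun x => (u x).1) q' :=
    A.evalFO_congr q' fun x hx => (hu (hfree hx)).symm
  have hw {w : ℕ → I.Dom} (hm : matches' I xs as w) : I.evalFO w q' ↔ A.evalFO v q' := by
    rw [hAu, hdi.evalFO_iff hc hr hresp hne e he]
    refine I.evalFO_congr q' fun x hx => ?_
    obtain ⟨a, ha, hxa⟩ := exists_mem_zip hlen (hfree hx)
    have h₁ : I.ind a = some (w x) := hm _ hxa
    have h₂ := he (u x)
    rw [hu (hfree hx), hv _ hxa] at h₂
    exact Option.some_injective _ (h₁.symm.trans h₂)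
  constructor
  · rintro ⟨w, hm, h₁, h₂⟩
    exact ⟨⟨w, hm, h₁⟩, (hw hm).1 h₂⟩
  · rintro ⟨⟨w, hm, h₁⟩, h₂⟩
    exact ⟨w, hm, h₁, (hw hm).2 h₂⟩

/-- Let `Q = (T, S_A, S_C, q(xs))` be an OMQC with `T` an
ALCHI TBox and `q` a CQ, and let `q'(xs)` be a domain-independent first-order
formula whose predicates all belong to `S_C`.  If `Q` is FO-rewritable and ABox
consistency is FO-rewritable for `(T, S_A, S_C)`, then the OMQC
`Q' = (T, S_A, S_C, q ∧ q')` is FO-rewritable. -/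
theorem statement_2 (T : ALCHITBox) (Sac Sar Scc Scr : Set ℕ)
    (hfinA : Sac.Finite ∧ Sar.Finite) (hsub : Scc ⊆ Sac ∧ Scr ⊆ Sar)
    (q q' : FO) (xs : List ℕ) (hxs : xs.Nodup)
    (hq : IsCQ q) (hfree : q.free ⊆ {x | x ∈ xs}) (hfree' : q'.free ⊆ {x | x ∈ xs})
    (hdi : DomIndep q') (hsigc : q'.cnames ⊆ Scc) (hsigr : q'.rnames ⊆ Scr)
    (hrw : FORewritable (fun A as => certAns (fun I => I.modelALCHI T) Scc Scr A q xs as)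
      (fun A => A.Fin ∧ A.usesOnly Sac Sar) xs)
    (hcons : ConsFORewritable (fun I => I.modelALCHI T) Scc Scr
      (fun A => A.Fin ∧ A.usesOnly Sac Sar)) :
    FORewritable
      (fun A as => certAns (fun I => I.modelALCHI T) Scc Scr A (.conj q q') xs as)
      (fun A => A.Fin ∧ A.usesOnly Sac Sar) xs := by
  obtain ⟨p, hp, hpc⟩ := hrw
  obtain ⟨s, hs, hsc⟩ := hcons
  have hfr : (FO.disj (.conj p q') (.neg s)).free ⊆ {x | x ∈ xs} := by
    simpa [FO.free, hs] using ⟨hp, hfree'⟩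
  refine FORewritable.of_nonempty _ hfr fun A hA hne as hlen has => ?_
  obtain ⟨v, hv⟩ := exists_zip_assignment (as := as) hxs
  have hp' : A.evalFO v p ↔ certAns (fun I => I.modelALCHI T) Scc Scr A q xs as := by
    rw [← ABox.satFO_iff hp hlen hv]
    exact hpc A hA as hlen has
  have hs' : A.evalFO v s ↔ consistentW (fun I => I.modelALCHI T) Scc Scr A := by
    rw [← hsc A hA]
    exact ⟨fun h w => (A.evalFO_congr s (by simp [hs])).1 h, fun h => h v⟩
  have hsat {I : Interp} (hI : I.modelA A) (hresp : I.respects A Scc Scr) :=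
    Interp.sat_conj_iff (q := q) hfree' hdi hsigc hsigr hI hresp hne hlen has hv
  rw [ABox.satFO_iff hfr hlen hv]
  constructor
  · rintro (⟨h₁, h₂⟩ | h) I hT hI hresp
    · exact (hsat hI hresp).2 ⟨hp'.1 h₁ I hT hI hresp, h₂⟩
    · exact absurd (hs'.2 ⟨I, hT, hI, hresp⟩) h
  · intro h
    by_cases hcon : consistentW (fun I => I.modelALCHI T) Scc Scr A
    · refine Or.inl ⟨hp'.2 fun I hT hI hresp => ?_, ?_⟩
      · exact ((hsat hI hresp).1 (h I hT hI hresp)).1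
      · obtain ⟨I, hT, hI, hresp⟩ := hcon
        exact ((hsat hI hresp).1 (h I hT hI hresp)).2
    · exact Or.inr fun hc => hcon (hs'.1 hc)


end DL
end
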